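/- Let C be a cycle with labeling γ : V(C) → ℤ changing by exactly ±1 along each edge. If every local minimum of C is a global minimum and every local maximum is a global maximum, then C has exactly as many local minima as local maxima, all local minima have the same γ-value m, all local maxima have the same γ-value M, and C decomposes into an alternating cyclic sequence of monotone paths each going from a vertex with value m to a vertex with value M or vice versa. -/

import Mathlib

/-- `i` is a local minimum of the labeled `n`-cycle `β` (its two cycle-neighbors,
`i+1` and `i-1 ≡ i+(n-1)`, have label one larger). -/
def LocMin (β : ℕ → ℤ) (n i : ℕ) : Prop :=
  β (i + (n - 1)) = β i + 1 ∧ β (i + 1) = β i + 1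

/-- `i` is a local maximum of the labeled `n`-cycle `β`. -/
def LocMax (β : ℕ → ℤ) (n i : ℕ) : Prop :=
  β (i + (n - 1)) = β i - 1 ∧ β (i + 1) = β i - 1

/-- `i` attains the minimum label on the (periodic) cycle. -/
def GlobMin (β : ℕ → ℤ) (i : ℕ) : Prop := ∀ j, β i ≤ β j

/-- `i` attains the maximum label on the (periodic) cycle. -/
def GlobMax (β : ℕ → ℤ) (i : ℕ) : Prop := ∀ j, β j ≤ β i

/-- The arc of `d` edges starting at `i` is monotone: labels increase by 1 at each step. -/
def MonoArc (β : ℕ → ℤ) (i d : ℕ) : Prop := ∀ t < d, β (i + t + 1) = β (i + t) + 1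

/-- The arc of `d` edges starting at `i` has labels decreasing by 1 at each step. -/
def AntiArc (β : ℕ → ℤ) (i d : ℕ) : Prop := ∀ t < d, β (i + t + 1) = β (i + t) - 1

/-- Every internal vertex of the arc of `d` edges starting at `i` has label strictly
between `lo` and `hi`. -/
def BetweenArc (β : ℕ → ℤ) (i d : ℕ) (lo hi : ℤ) : Prop :=
  ∀ t, 0 < t → t < d → lo < β (i + t) ∧ β (i + t) < hi

theorem shift_sum (n : ℕ) (β : ℕ → ℤ) (hper : ∀ i, β (i + n) = β i) (k : ℕ) :
    ∑ i ∈ Finset.range n, β (i + k) = ∑ i ∈ Finset.range n, β i := by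
  induction k with
  | zero => simp
  | succ k ih =>
    rw [← ih]
    have h1 := Finset.sum_range_succ (fun i => β (i + k)) n
    have h2 := Finset.sum_range_succ' (fun i => β (i + k)) n
    have h3 : β (n + k) = β (0 + k) := by
      rw [Nat.add_comm n k, hper, Nat.zero_add]
    have h4 : ∑ i ∈ Finset.range n, β (i + (k + 1)) = ∑ i ∈ Finset.range n, β (i + 1 + k) :=
      Finset.sum_congr rfl (fun i _ => by congr 1; omega)
    linarith

theorem up_arc (n : ℕ) (hn : 3 ≤ n) (β : ℕ → ℤ)
    (hper : ∀ i, β (i + n) = β i) (hstep : ∀ i, |β (i + 1) - β i| = 1)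
    (i : ℕ) (hi : LocMin β n i) :
    ∃ d, 0 < d ∧ d ≤ n ∧ MonoArc β i d ∧ LocMax β n (i + d) := by
  classical
  have key : ∃ d, d ≤ n ∧ β (i + d + 1) ≠ β (i + d) + 1 := by
    by_contra! hcon
    have h : ∀ t, t ≤ n → β (i + t) = β i + t := by
      intro t
      induction t with
      | zero => simp
      | succ t ih =>
        intro ht
        have h1 := ih (by omega)
        have h2 := hcon t (by omega)
        rw [← Nat.add_assoc, h2, h1]
        push_cast
        ring
    have h1 := h n le_rfl
    rw [hper] at h1
    omega
  obtain ⟨hd1, hd2⟩ := Nat.find_spec key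
  have hmin : ∀ t < Nat.find key, β (i + t + 1) = β (i + t) + 1 := by
    intro t ht
    have := Nat.find_min key ht
    by_contra hc
    exact this ⟨by omega, hc⟩
  generalize Nat.find key = d at *
  have hpos : 0 < d := by
    rcases Nat.eq_zero_or_pos d with h | h
    · subst h
      exact absurd hi.2 hd2
    · exact h
  refine ⟨d, hpos, hd1, hmin, ?_, ?_⟩
  · have h1 := hmin (d - 1) (by omega)
    have e1 : i + d + (n - 1) = i + (d - 1) + n := by omega
    have e2 : i + (d - 1) + 1 = i + d := by omega
    rw [e2] at h1
    rw [e1, hper]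
    omega
  · have := hstep (i + d)
    rcases (abs_eq (by norm_num)).1 this with h | h <;> omega

theorem down_arc (n : ℕ) (hn : 3 ≤ n) (β : ℕ → ℤ)
    (hper : ∀ i, β (i + n) = β i) (hstep : ∀ i, |β (i + 1) - β i| = 1)
    (i : ℕ) (hi : LocMax β n i) :
    ∃ d, 0 < d ∧ d ≤ n ∧ AntiArc β i d ∧ LocMin β n (i + d) := by
  obtain ⟨d, h0, h1, h2, h3⟩ := up_arc n hn (fun j => - β j) (fun j => by simp [hper])
    (fun j => by rw [← hstep j, ← abs_neg]; congr 1; ring) i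
    ⟨by have := hi.1; simp only; omega, by have := hi.2; simp only; omega⟩
  refine ⟨d, h0, h1, fun t ht => ?_, ?_, ?_⟩
  · have := h2 t ht
    simp only at this
    omega
  · have := h3.1
    simp only at this
    omega
  · have := h3.2
    simp only at this
    omega

theorem card_eq (n : ℕ) (hn : 3 ≤ n) (β : ℕ → ℤ)
    (hper : ∀ i, β (i + n) = β i) (hstep : ∀ i, |β (i + 1) - β i| = 1) :
    Nat.card {i : ℕ // i < n ∧ LocMin β n i} = Nat.card {i : ℕ // i < n ∧ LocMax β n i} := by
  classical
  have hc : ∀ p : ℕ → Prop, ((Nat.card {i : ℕ // i < n ∧ p i} : ℕ) : ℤ)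
      = ∑ i ∈ Finset.range n, if p i then 1 else 0 := by
    intro p
    rw [Finset.sum_boole, Nat.subtype_card]
    intro x
    simp
  have hpt : ∀ i, 2 * (if LocMin β n i then (1 : ℤ) else 0) - 2 * (if LocMax β n i then 1 else 0)
      = β (i + 1) + β (i + (n - 1)) - 2 * β i := by
    intro i
    have h1 := hstep i
    have h2 := hstep (i + (n - 1))
    have e : i + (n - 1) + 1 = i + n := by omega
    rw [e, hper] at h2
    unfold LocMin LocMax
    rcases (abs_eq (by norm_num)).1 h1 with h | h <;>
    rcases (abs_eq (by norm_num)).1 h2 with h3 | h3 <;> split_ifs <;> omega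
  have hs := Finset.sum_congr (rfl : Finset.range n = Finset.range n) (fun i _ => hpt i)
  simp only [Finset.sum_sub_distrib, Finset.sum_add_distrib, ← Finset.mul_sum,
    shift_sum n β hper, ← hc] at hs
  omega

/-- if on a ±1-labeled cycle every local minimum is a global minimum and
every local maximum is a global maximum, then there are as many local minima as local
maxima, all local minima share a common label `m`, all local maxima share a common label
`M`, and the cycle decomposes into an alternating cyclic sequence of monotone arcs, each
running from a local minimum (value `m`) to a local maximum (value `M`) or vice versa. -/
theorem stmt_9 (n : ℕ) (hn : 3 ≤ n) (β : ℕ → ℤ)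
    (hper : ∀ i, β (i + n) = β i) (hstep : ∀ i, |β (i + 1) - β i| = 1)
    (hjag : ∀ i, (LocMin β n i → GlobMin β i) ∧ (LocMax β n i → GlobMax β i)) :
    Nat.card {i : ℕ // i < n ∧ LocMin β n i} = Nat.card {i : ℕ // i < n ∧ LocMax β n i} ∧
    ∃ m M : ℤ,
      (∀ i, LocMin β n i → β i = m) ∧
      (∀ i, LocMax β n i → β i = M) ∧
      (∀ i, LocMin β n i → ∃ d, 0 < d ∧ d ≤ n ∧ MonoArc β i d ∧ LocMax β n (i + d)) ∧
      (∀ i, LocMax β n i → ∃ d, 0 < d ∧ d ≤ n ∧ AntiArc β i d ∧ LocMin β n (i + d)) := by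
  classical
  refine ⟨card_eq n hn β hper hstep,
    if h : ∃ i, LocMin β n i then β h.choose else 0,
    if h : ∃ i, LocMax β n i then β h.choose else 0, ?_, ?_,
    up_arc n hn β hper hstep, down_arc n hn β hper hstep⟩
  · intro i hi
    have h : ∃ i, LocMin β n i := ⟨i, hi⟩
    rw [dif_pos h]
    exact le_antisymm ((hjag i).1 hi _) ((hjag _).1 h.choose_spec _)
  · intro i hi
    have h : ∃ i, LocMax β n i := ⟨i, hi⟩
    rw [dif_pos h]
    exact le_antisymm ((hjag _).2 h.choose_spec _) ((hjag i).2 hi _)
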